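/- Let G be a connected vertex-transitive non-bipartite triangle-free simple graph of degree 5 and even order that is not 4-factor-critical, and suppose λ₆(G) = λ₇(G) = 12. Then every λ₇-atom S of G is an imprimitive block of G. -/

import Mathlib

open SimpleGraph

section Defs

variable {V : Type*}

/-- A simple graph is vertex-transitive if any vertex can be mapped to any other
by a graph automorphism. -/
def VertexTransitive (G : SimpleGraph V) : Prop :=
  ∀ x y : V, ∃ φ : G ≃g G, φ x = y

/-- A graph is `p`-factor-critical if the removal of any set of `p` vertices
results in a graph with a perfect matching. -/
def PFactorCritical (G : SimpleGraph V) (p : ℕ) : Prop :=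
  ∀ X : Set V, X.ncard = p → ∃ M : (G.induce Xᶜ).Subgraph, M.IsPerfectMatching

/-- A graph is factor-critical if the removal of any single vertex results in a
graph with a perfect matching. -/
def IsFactorCritical {W : Type*} (H : SimpleGraph W) : Prop :=
  ∀ v : W, ∃ M : (H.induce ({v}ᶜ : Set W)).Subgraph, M.IsPerfectMatching

/-- `∇(X)`: the set of edges of `G` with exactly one end in `X`. -/
def edgeBoundary (G : SimpleGraph V) (X : Set V) : Set (Sym2 V) :=
  {e | e ∈ G.edgeSet ∧ ∃ x ∈ X, ∃ y ∈ Xᶜ, e = s(x, y)}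

/-- The set of edges of `G` with both ends in `X`. -/
def edgesWithin (G : SimpleGraph V) (X : Set V) : Set (Sym2 V) :=
  {e | e ∈ G.edgeSet ∧ ∀ v ∈ e, v ∈ X}

/-- The set of edges of `G` with one end in `A` and the other end in `S \ A`
(i.e. the edge boundary of `A` inside the induced subgraph `G[S]` when `A ⊆ S`). -/
def inducedEdgeBoundary (G : SimpleGraph V) (S A : Set V) : Set (Sym2 V) :=
  {e | e ∈ G.edgeSet ∧ ∃ x ∈ A, ∃ y ∈ S \ A, e = s(x, y)}

/-- `F` is an `s`-restricted edge-cut of `G` if deleting `F` disconnects `G` and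
every component of `G − F` has at least `s` vertices. -/
def IsRestrictedEdgeCut (G : SimpleGraph V) (s : ℕ) (F : Set (Sym2 V)) : Prop :=
  F ⊆ G.edgeSet ∧ ¬ (G.deleteEdges F).Connected ∧
    ∀ c : (G.deleteEdges F).ConnectedComponent, s ≤ c.supp.ncard

/-- `λ_s(G)`: the minimum cardinality of an `s`-restricted edge-cut of `G`. -/
noncomputable def lambdaS (G : SimpleGraph V) (s : ℕ) : ℕ :=
  sInf (Set.ncard '' {F | IsRestrictedEdgeCut G s F})

/-- A `λ_s`-fragment: a vertex set whose edge boundary is an `s`-restricted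
edge-cut of minimum cardinality `λ_s(G)`. -/
def IsLambdaFragment (G : SimpleGraph V) (s : ℕ) (X : Set V) : Prop :=
  IsRestrictedEdgeCut G s (edgeBoundary G X) ∧ (edgeBoundary G X).ncard = lambdaS G s

/-- A `λ_s`-atom: a `λ_s`-fragment of minimum cardinality. -/
def IsLambdaAtom (G : SimpleGraph V) (s : ℕ) (X : Set V) : Prop :=
  IsLambdaFragment G s X ∧ ∀ Y : Set V, IsLambdaFragment G s Y → X.ncard ≤ Y.ncard

/-- The odd girth of `G`: the length of a shortest odd cycle of `G`. -/
noncomputable def oddGirth (G : SimpleGraph V) : ℕ :=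
  sInf {n | Odd n ∧ ∃ (v : V) (c : G.Walk v v), c.IsCycle ∧ c.length = n}

/-- `X` is an independent set of `G`. -/
def IsIndependentSet (G : SimpleGraph V) (X : Set V) : Prop :=
  ∀ x ∈ X, ∀ y ∈ X, ¬ G.Adj x y

/-- The independence number `α(G)`. -/
noncomputable def indepNum (G : SimpleGraph V) : ℕ :=
  sSup {n | ∃ X : Set V, IsIndependentSet G X ∧ X.ncard = n}

/-- The number of trivial (single-vertex) components of `G − X`. -/
noncomputable def trivialComponentCount (G : SimpleGraph V) (X : Set V) : ℕ :=
  {c : (G.induce Xᶜ).ConnectedComponent | c.supp.ncard = 1}.ncard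

/-- The number of odd components of `G − X`. -/
noncomputable def oddComponentCount (G : SimpleGraph V) (X : Set V) : ℕ :=
  {c : (G.induce Xᶜ).ConnectedComponent | Odd c.supp.ncard}.ncard

/-- The number of nontrivial components of `G − X`. -/
noncomputable def nontrivialComponentCount (G : SimpleGraph V) (X : Set V) : ℕ :=
  {c : (G.induce Xᶜ).ConnectedComponent | 2 ≤ c.supp.ncard}.ncard

/-- An imprimitive block of `G`: a proper non-empty vertex set that every
automorphism either fixes setwise or maps to a disjoint set. -/
def IsImprimitiveBlock (G : SimpleGraph V) (X : Set V) : Prop :=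
  X.Nonempty ∧ X ≠ Set.univ ∧ ∀ φ : G ≃g G, (⇑φ) '' X = X ∨ ((⇑φ) '' X) ∩ X = ∅

/-- A connected graph is `q`-extendable if it has a perfect matching and every
matching of size `q` is contained in a perfect matching. -/
def Extendable (G : SimpleGraph V) (q : ℕ) : Prop :=
  (∃ M : G.Subgraph, M.IsPerfectMatching) ∧
    ∀ M : G.Subgraph, M.IsMatching → M.edgeSet.ncard = q →
      ∃ P : G.Subgraph, P.IsPerfectMatching ∧ M ≤ P

end Defs

namespace Aux

open Finset

set_option linter.unusedSectionVars false

theorem cycle_two_colorable {W : Type*} [Fintype W] [DecidableEq W] (Q : SimpleGraph W)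
    [DecidableRel Q.Adj] (hc : Q.Connected) (hev : Even (Fintype.card W))
    (h2 : ∀ v, (Q.neighborSet v).ncard = 2) : Q.Colorable 2 := by
  have hcyc : Q.IsCycles := fun v _ => h2 v
  obtain ⟨v⟩ := hc.nonempty
  have hne : (Q.neighborSet v).Nonempty := by
    apply Set.nonempty_of_ncard_ne_zero; rw [h2 v]; norm_num
  obtain ⟨p, hp, hverts⟩ := hcyc.exists_cycle_toSubgraph_verts_eq_connectedComponentSupp
    (c := Q.connectedComponentMk v) (v := v) rfl hne
  have hall : ∀ w, w ∈ p.toSubgraph.verts := by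
    intro w
    rw [hverts, ConnectedComponent.mem_supp_iff, ConnectedComponent.eq]
    exact hc.preconnected w v
  have hadj : ∀ x y, Q.Adj x y → p.toSubgraph.Adj x y := fun x y h =>
    (hp.adj_toSubgraph_iff_of_isCycles hcyc (hall x) y).2 h
  have hlt : 0 < p.length := by have := hp.three_le_length; omega
  have hidx : ∀ w, ∃ i, i < p.length ∧ p.getVert i = w := by
    intro w
    have := hall w
    rw [Walk.mem_verts_toSubgraph, Walk.mem_support_iff_exists_getVert] at this
    obtain ⟨i, hi, hl⟩ := this
    by_cases h : i = p.length
    · refine ⟨0, hlt, ?_⟩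
      rw [← hi, h, Walk.getVert_length, Walk.getVert_zero]
    · exact ⟨i, by omega, hi⟩
  have hinj : ∀ i j, i < p.length → j < p.length → p.getVert i = p.getVert j → i = j := by
    intro i j hi hj h
    exact hp.getVert_injOn' (by rw [Set.mem_ofPred_eq]; omega) (by rw [Set.mem_ofPred_eq]; omega) h
  have hlen : p.length = Fintype.card W := by
    have : Function.Bijective (fun i : Fin p.length => p.getVert i) := by
      constructor
      · intro i j h; exact Fin.ext (hinj _ _ i.2 j.2 h)
      · intro w; obtain ⟨i, hi, h⟩ := hidx w; exact ⟨⟨i, hi⟩, h⟩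
    simpa using Fintype.card_of_bijective this
  choose f hf hfv using hidx
  have hff : ∀ i, i < p.length → f (p.getVert i) = i := fun i hi =>
    hinj _ _ (hf _) hi (hfv _)
  have key : ∀ i, i < p.length →
      f (p.getVert i) % 2 ≠ f (p.getVert (i+1)) % 2 := by
    intro i hi
    rw [hff i hi]
    by_cases h : i + 1 = p.length
    · rw [h, Walk.getVert_length]
      have : f v = 0 := by have := hff 0 hlt; rwa [Walk.getVert_zero] at this
      rw [this]
      rw [← hlen, Nat.even_iff] at hev
      omega
    · rw [hff (i+1) (by omega)]; omega
  refine ⟨Coloring.mk (fun w => (⟨f w % 2, Nat.mod_lt _ (by norm_num)⟩ : Fin 2)) ?_⟩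
  intro x y hxy
  obtain ⟨i, hi, hl⟩ := p.toSubgraph_adj_iff.1 (hadj x y hxy)
  intro h
  have h' : f x % 2 = f y % 2 := congrArg Fin.val h
  rcases Sym2.eq_iff.1 hi with ⟨rfl, rfl⟩ | ⟨rfl, rfl⟩
  · exact key i hl h'
  · exact key i hl h'.symm

theorem closed_univ {W : Type*} {H : SimpleGraph W} {A : Set W}
    (hA : ∀ x ∈ A, ∀ y, H.Adj x y → y ∈ A) {u v : W} (h : H.Reachable u v) (hu : u ∈ A) :
    v ∈ A := by
  obtain ⟨p⟩ := h
  induction p with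
  | nil => exact hu
  | cons h p ih => exact ih (hA _ hu _ h)

section Cut

variable {V : Type*} [Fintype V] [DecidableEq V] (G : SimpleGraph V) [DecidableRel G.Adj]

def cut (A : Finset V) : ℕ := #(G.interedges A Aᶜ)

theorem inter_comm (A B : Finset V) : #(G.interedges A B) = #(G.interedges B A) := by
  have := G.symm
  exact Rel.card_interedges_comm A B

theorem inter_union_left {A B : Finset V} (h : Disjoint A B) (C : Finset V) :
    #(G.interedges (A ∪ B) C) = #(G.interedges A C) + #(G.interedges B C) := by
  rw [← card_union_of_disjoint (G.interedges_disjoint_left h C)]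
  congr 1
  ext ⟨x, y⟩
  simp only [mem_interedges_iff, mem_union]; tauto

theorem inter_union_right {A B : Finset V} (h : Disjoint A B) (C : Finset V) :
    #(G.interedges C (A ∪ B)) = #(G.interedges C A) + #(G.interedges C B) := by
  rw [inter_comm, inter_union_left G h, inter_comm, inter_comm G B]

theorem inter_eq_sum (A B : Finset V) :
    #(G.interedges A B) = ∑ x ∈ A, #(G.neighborFinset x ∩ B) := by
  rw [interedges_def, card_filter, sum_product]
  refine sum_congr rfl fun x _ => ?_
  rw [← card_filter]
  congr 1
  ext y
  simp [and_comm]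

theorem cut_compl (A : Finset V) : cut G Aᶜ = cut G A := by
  unfold cut; rw [compl_compl, inter_comm]

theorem inter_univ (hreg : G.IsRegularOfDegree 5) (A : Finset V) :
    #(G.interedges A univ) = 5 * #A := by
  rw [inter_eq_sum, sum_congr rfl (g := fun _ => 5)]
  · simp [mul_comm]
  · intro x _; rw [Finset.inter_univ, card_neighborFinset_eq_degree]; exact hreg x

theorem cut_add (hreg : G.IsRegularOfDegree 5) (A : Finset V) :
    cut G A + #(G.interedges A A) = 5 * #A := by
  rw [← inter_univ G hreg A, ← union_compl A, inter_union_right G disjoint_compl_right, cut]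
  rw [add_comm]

theorem cut_split {A C : Finset V} (hC : C ⊆ A)
    (hno : ∀ x ∈ C, ∀ y ∈ A, G.Adj x y → y ∈ C) :
    cut G A = cut G C + cut G (A \ C) := by
  have e1 : #(G.interedges C (A \ C)) = 0 := by
    rw [card_eq_zero, eq_empty_iff_forall_notMem]
    rintro ⟨x, y⟩ h
    simp only [mem_interedges_iff, mem_sdiff] at h
    exact h.2.1.2 (hno x h.1 y h.2.1.1 h.2.2)
  have d1 : Disjoint C (A \ C) := disjoint_sdiff
  have hA : A = C ∪ (A \ C) := (union_sdiff_of_subset hC).symm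
  have hCc : Cᶜ = Aᶜ ∪ (A \ C) := by
    ext x; have := @hC x; simp only [mem_compl, mem_union, mem_sdiff]; tauto
  have hDc : (A \ C)ᶜ = Aᶜ ∪ C := by
    ext x; have := @hC x; simp only [mem_compl, mem_union, mem_sdiff]; tauto
  have d2 : Disjoint Aᶜ (A \ C) := disjoint_compl_left.mono_right sdiff_subset
  have d3 : Disjoint Aᶜ C := disjoint_compl_left.mono_right hC
  have h1 : cut G A = #(G.interedges C Aᶜ) + #(G.interedges (A \ C) Aᶜ) := by
    rw [← inter_union_left G d1, ← hA, cut]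
  rw [h1, cut, cut, hCc, hDc, inter_union_right G d2, inter_union_right G d3, e1,
    inter_comm G (A \ C) C, e1]
  rfl

theorem cut_pos (hconn : G.Connected) {A : Finset V} (h1 : A.Nonempty) (h2 : Aᶜ.Nonempty) :
    0 < cut G A := by
  by_contra h
  have h0 : G.interedges A Aᶜ = ∅ := by
    rw [← card_eq_zero]; unfold cut at h; omega
  obtain ⟨a, ha⟩ := h1
  obtain ⟨b, hb⟩ := h2
  have : b ∈ (A : Set V) := by
    refine closed_univ (H := G) ?_ (hconn.preconnected a b) ha
    intro x hx y hxy
    by_contra hy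
    have : (x, y) ∈ G.interedges A Aᶜ := by
      rw [mem_interedges_iff]; exact ⟨hx, by simpa using hy, hxy⟩
    rw [h0] at this; simp at this
  simp at hb; exact hb this

theorem small_inner (htri : G.CliqueFree 3) (B : Finset V) :
    ∃ Δ, Δ ≤ #B ∧ #(G.interedges B B) ≤ 2 * ((#B - Δ) * Δ) := by
  rcases B.eq_empty_or_nonempty with rfl | hne
  · exact ⟨0, by simp, by simp⟩
  obtain ⟨u, hu, hmax⟩ := B.exists_max_image (fun x => #(G.neighborFinset x ∩ B)) hne
  set N := G.neighborFinset u ∩ B with hN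
  have hNB : N ⊆ B := inter_subset_right
  refine ⟨#N, card_le_card hNB, ?_⟩
  have hNN : #(G.interedges N N) = 0 := by
    rw [card_eq_zero, eq_empty_iff_forall_notMem]
    rintro ⟨x, y⟩ h
    simp only [mem_interedges_iff, hN, mem_inter, mem_neighborFinset] at h
    exact htri {u, x, y} (is3Clique_triple_iff.2 ⟨h.1.1, h.2.1.1, h.2.2⟩)
  have hD : #(G.interedges (B \ N) B) ≤ (#B - #N) * #N := by
    rw [inter_eq_sum, ← card_sdiff_of_subset hNB, ← smul_eq_mul]
    exact sum_le_card_nsmul _ _ _ fun x hx => hmax x (mem_sdiff.1 hx).1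
  have hd : Disjoint N (B \ N) := disjoint_sdiff
  have e : B = N ∪ (B \ N) := (union_sdiff_of_subset hNB).symm
  have h1 : #(G.interedges B B) = #(G.interedges N B) + #(G.interedges (B \ N) B) := by
    rw [← inter_union_left G hd, ← e]
  have h2 : #(G.interedges N B) = #(G.interedges N N) + #(G.interedges N (B \ N)) := by
    rw [← inter_union_right G hd, ← e]
  have h3 : #(G.interedges N (B \ N)) ≤ #(G.interedges (B \ N) B) := by
    rw [inter_comm]; exact card_le_card (G.interedges_mono subset_rfl hNB)
  omega

theorem cut_small (htri : G.CliqueFree 3) (hreg : G.IsRegularOfDegree 5) (B : Finset V)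
    (h3 : 3 ≤ #B) (h5 : #B ≤ 5) : 11 ≤ cut G B := by
  have h := cut_add G hreg B
  obtain ⟨Δ, hΔ, hb⟩ := small_inner G htri B
  generalize #B = b at *
  have : (b - Δ) * Δ ≤ 2 ∧ b = 3 ∨ (b - Δ) * Δ ≤ 4 ∧ b = 4 ∨ (b - Δ) * Δ ≤ 6 ∧ b = 5 := by
    interval_cases b <;> interval_cases Δ <;> simp
  omega

theorem ncard_boundary (A : Finset V) : (edgeBoundary G (A : Set V)).ncard = cut G A := by
  rw [cut, ← Set.ncard_coe_finset]
  symm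
  refine Set.ncard_congr (fun x _ => s(x.1, x.2)) ?_ ?_ ?_
  · rintro ⟨x, y⟩ h
    simp only [mem_coe, mem_interedges_iff, mem_compl] at h
    exact ⟨h.2.2, x, h.1, y, by simpa using h.2.1, rfl⟩
  · rintro ⟨x, y⟩ ⟨x', y'⟩ h h' he
    simp only [mem_coe, mem_interedges_iff, mem_compl] at h h'
    rcases Sym2.eq_iff.1 he with ⟨h1, h2⟩ | ⟨h1, h2⟩
    · simp only at h1 h2; rw [h1, h2]
    · simp only at h1 h2; subst h1; exact absurd h.1 h'.2.1
  · rintro e ⟨he, x, hx, y, hy, rfl⟩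
    refine ⟨(x, y), ?_, rfl⟩
    simp only [mem_coe, mem_interedges_iff, mem_compl]
    exact ⟨hx, by simpa using hy, he⟩

theorem cut_ge (hconn : G.Connected) (htri : G.CliqueFree 3) (hreg : G.IsRegularOfDegree 5)
    (h6 : lambdaS G 6 = 12) : ∀ A : Finset V, 3 ≤ #A → 3 ≤ #Aᶜ → 11 ≤ cut G A := by
  -- take a counterexample of minimum cut
  intro A0 hA0 hA0c
  by_contra hlt0
  obtain ⟨A, hA, hmin⟩ := (univ.filter fun A : Finset V => 3 ≤ #A ∧ 3 ≤ #Aᶜ).exists_min_image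
    (cut G) ⟨A0, by simp [hA0, hA0c]⟩
  have hle := hmin A0 (by simp [hA0, hA0c])
  simp only [mem_filter, mem_univ, true_and] at hA hmin
  have hlt : cut G A ≤ 10 := by omega
  -- no small closed pieces
  have piece : ∀ B C : Finset V, 3 ≤ #B → 3 ≤ #Bᶜ → cut G B = cut G A → C ⊆ B → C.Nonempty →
      (∀ x ∈ C, ∀ y ∈ B, G.Adj x y → y ∈ C) → 6 ≤ #C := by
    intro B C hB hBc hcB hCB hCne hno
    by_contra hC6
    have hs := cut_split G hCB hno
    have hcard : #(B \ C) + #C = #B := card_sdiff_add_card_eq_card hCB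
    by_cases hC3 : 3 ≤ #C
    · have := cut_small G htri hreg C hC3 (by omega)
      omega
    · have hCc : Cᶜ.Nonempty := by
        have : #Bᶜ ≤ #Cᶜ := card_le_card (compl_subset_compl.2 hCB)
        rw [← card_pos]; omega
      have hp := cut_pos G hconn hCne hCc
      by_cases hD : 3 ≤ #(B \ C)
      · have h1 : #Bᶜ ≤ #(B \ C)ᶜ := card_le_card (compl_subset_compl.2 sdiff_subset)
        have := hmin (B \ C) ⟨hD, by omega⟩
        omega
      · have := cut_small G htri hreg B hB (by omega)
        omega
  have hcutset : IsRestrictedEdgeCut G 6 (edgeBoundary G (A : Set V)) := by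
    set H := G.deleteEdges (edgeBoundary G (A : Set V)) with hH
    have hHadj : ∀ x y, H.Adj x y ↔ G.Adj x y ∧ (x ∈ A ↔ y ∈ A) := by
      intro x y
      rw [hH, deleteEdges_adj]
      constructor
      · rintro ⟨h, hn⟩
        refine ⟨h, ?_⟩
        by_contra hxy
        apply hn
        by_cases hx : x ∈ A
        · exact ⟨h, x, hx, y, by simp; tauto, rfl⟩
        · exact ⟨h, y, by simp; tauto, x, by simpa using hx, Sym2.eq_swap⟩
      · rintro ⟨h, hiff⟩
        refine ⟨h, ?_⟩
        rintro ⟨_, a, ha, b, hb, he⟩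
        have ha' : a ∈ A := ha
        have hb' : b ∉ A := hb
        rcases Sym2.eq_iff.1 he with ⟨rfl, rfl⟩ | ⟨rfl, rfl⟩ <;> tauto
    have hcl : ∀ x ∈ A, ∀ y, H.Adj x y → y ∈ A := fun x hx y h => ((hHadj x y).1 h).2.1 hx
    have hcl' : ∀ x ∈ Aᶜ, ∀ y, H.Adj x y → y ∈ Aᶜ := fun x hx y h => by
      have := ((hHadj x y).1 h).2
      simp only [mem_compl] at hx ⊢; tauto
    refine ⟨fun e he => he.1, ?_, ?_⟩
    · intro hc
      obtain ⟨a, ha⟩ : A.Nonempty := by rw [← card_pos]; omega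
      obtain ⟨b, hb⟩ : Aᶜ.Nonempty := by rw [← card_pos]; omega
      have := closed_univ (A := (A : Set V)) (fun x hx y h => hcl x hx y h)
        (hc.preconnected a b) ha
      simp at hb; exact hb this
    · intro c
      classical
      set C : Finset V := c.supp.toFinite.toFinset with hC
      have hCm : ∀ x, x ∈ C ↔ x ∈ c.supp := by intro x; simp [hC]
      have hCcard : c.supp.ncard = #C := by
        rw [← Set.ncard_coe_finset]; congr 1; ext x; simp [hCm]
      rw [hCcard]
      obtain ⟨v, hv⟩ := c.nonempty_supp
      have hreach : ∀ x ∈ C, H.Reachable v x := by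
        intro x hx
        rw [hCm, ConnectedComponent.mem_supp_iff] at hx
        rw [ConnectedComponent.mem_supp_iff] at hv
        exact ConnectedComponent.eq.1 (hv.trans hx.symm)
      have hCadj : ∀ x ∈ C, ∀ y, H.Adj x y → y ∈ C := by
        intro x hx y h
        rw [hCm] at hx ⊢
        exact (ConnectedComponent.mem_supp_congr_adj c h).1 hx
      have hCne : C.Nonempty := ⟨v, (hCm v).2 hv⟩
      by_cases hvA : v ∈ A
      · have hCA : C ⊆ A := fun x hx =>
          closed_univ (A := (A : Set V)) (fun x hx y h => hcl x hx y h) (hreach x hx) hvA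
        exact piece A C hA.1 hA.2 rfl hCA hCne fun x hx y hy h =>
          hCadj x hx y ((hHadj x y).2 ⟨h, by simp [hCA hx, hy]⟩)
      · have hCA : C ⊆ Aᶜ := fun x hx =>
          closed_univ (A := ((Aᶜ : Finset V) : Set V)) (fun x hx y h => hcl' x hx y h)
            (hreach x hx) (by simpa using hvA)
        refine piece Aᶜ C hA.2 (by rw [compl_compl]; exact hA.1) (cut_compl G A) hCA hCne
          fun x hx y hy h => hCadj x hx y ((hHadj x y).2 ⟨h, ?_⟩)
        have h1 := hCA hx
        simp only [mem_compl] at h1 hy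
        tauto
  have : lambdaS G 6 ≤ cut G A := by
    rw [← ncard_boundary]
    exact Nat.sInf_le ⟨_, hcutset, rfl⟩
  omega

end Cut

section Tutte

variable {V : Type*} [Fintype V] [DecidableEq V] (G : SimpleGraph V) [DecidableRel G.Adj]

theorem tutte_family (heven : Even (Fintype.card V)) (hnfc : ¬ PFactorCritical G 4) :
    ∃ (X : Finset V) (𝒞 : Finset (Finset V)), 4 ≤ #X ∧ #X ≤ #𝒞 + 2 ∧
      (∀ C ∈ 𝒞, ∀ D ∈ 𝒞, C ≠ D → Disjoint C D) ∧
      ∀ C ∈ 𝒞, Odd #C ∧ Disjoint C X ∧ ∀ x ∈ C, ∀ y, G.Adj x y → y ∈ C ∨ y ∈ X := by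
  classical
  unfold PFactorCritical at hnfc
  push Not at hnfc
  obtain ⟨X0, hX0, hno⟩ := hnfc
  have ht : ¬ ∃ M : (G.induce X0ᶜ).Subgraph, M.IsPerfectMatching := by
    rintro ⟨M, hM⟩; exact hno M hM
  rw [SimpleGraph.tutte] at ht
  push Not at ht
  obtain ⟨u, hu⟩ := ht
  unfold IsTutteViolator at hu
  set S := (⊤ : (G.induce X0ᶜ).Subgraph).deleteVerts u with hS
  set K := S.coe with hK
  have hSv : ∀ w, w ∈ S.verts ↔ w ∉ u := by intro w; simp [hS]
  let g : S.verts → V := fun w => w.1.1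
  have hg : Function.Injective g := fun a b h => Subtype.ext (Subtype.ext h)
  -- parity
  have hpar := odd_ncard_oddComponents (G := K)
  have hcard : Nat.card S.verts + u.ncard + 4 = Fintype.card V := by
    have h1 : S.verts = uᶜ := by ext w; rw [hSv]; rfl
    have h2 : Nat.card S.verts = (uᶜ).ncard := by rw [h1]; rfl
    have h3 := Set.ncard_add_ncard_compl u
    have h4 := Set.ncard_add_ncard_compl X0
    have h5 : Nat.card (X0ᶜ : Set V) = (X0ᶜ).ncard := rfl
    rw [Nat.card_eq_fintype_card] at h4
    omega
  have hoc : u.ncard + 2 ≤ K.oddComponents.ncard := by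
    have hu' : u.ncard < K.oddComponents.ncard := hu
    rw [Nat.odd_iff, Nat.odd_iff] at hpar
    rw [Nat.even_iff] at heven
    omega
  let f : K.ConnectedComponent → Finset V := fun c => (g '' c.supp).toFinite.toFinset
  have hf : ∀ c x, x ∈ f c ↔ ∃ w ∈ c.supp, g w = x := by intro c x; simp [f]
  have hdisj : ∀ c d, c ≠ d → Disjoint (f c) (f d) := by
    intro c d hcd
    rw [Finset.disjoint_left]
    intro x hc hd
    obtain ⟨w, hw, rfl⟩ := (hf _ _).1 hc
    obtain ⟨w', hw', h⟩ := (hf _ _).1 hd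
    have := hg h
    subst this
    rw [ConnectedComponent.mem_supp_iff] at hw hw'
    exact hcd (hw.symm.trans hw')
  have hfinj : Function.Injective f := by
    intro c d hcd
    by_contra hne
    have h1 := hdisj c d hne
    rw [← hcd, disjoint_self_iff_empty] at h1
    obtain ⟨w, hw⟩ := c.nonempty_supp
    have : g w ∈ f c := (hf _ _).2 ⟨w, hw, rfl⟩
    rw [h1] at this; simp at this
  let X : Finset V := (X0 ∪ Subtype.val '' u).toFinite.toFinset
  have hX : ∀ x, x ∈ X ↔ x ∈ X0 ∨ ∃ h : x ∈ X0ᶜ, (⟨x, h⟩ : (X0ᶜ : Set V)) ∈ u := by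
    intro x; simp [X]
  have hXc : #X = 4 + u.ncard := by
    have hXe : #X = (X0 ∪ Subtype.val '' u).ncard := (Set.ncard_eq_toFinset_card _ _).symm
    rw [hXe, Set.ncard_union_eq, hX0,
      Set.ncard_image_of_injective _ Subtype.val_injective]
    rw [Set.disjoint_left]
    rintro x hx ⟨w, _, rfl⟩
    exact w.2 hx
  refine ⟨X, K.oddComponents.toFinite.toFinset.image f, by omega, ?_, ?_, ?_⟩
  · have := Set.ncard_eq_toFinset_card K.oddComponents K.oddComponents.toFinite
    rw [card_image_of_injective _ hfinj]; omega
  · intro C hC D hD hne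
    obtain ⟨c, _, rfl⟩ := mem_image.1 hC
    obtain ⟨d, _, rfl⟩ := mem_image.1 hD
    exact hdisj c d fun h => hne (by rw [h])
  · intro C hC
    obtain ⟨c, hc, rfl⟩ := mem_image.1 hC
    refine ⟨?_, ?_, ?_⟩
    · have : #(f c) = c.supp.ncard := by
        rw [← Set.ncard_eq_toFinset_card, Set.ncard_image_of_injective _ hg]
      rw [this]
      simpa using hc
    · rw [Finset.disjoint_left]
      intro x hx hxX
      obtain ⟨w, hw, rfl⟩ := (hf _ _).1 hx
      rcases (hX _).1 hxX with h | ⟨h, h'⟩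
      · exact w.1.2 h
      · exact (hSv w.1).1 w.2 h'
    · intro x hx y hxy
      obtain ⟨w, hw, rfl⟩ := (hf _ _).1 hx
      by_cases hy : y ∈ X
      · exact Or.inr hy
      · left
        rw [hX] at hy
        push Not at hy
        have hy1 : y ∈ X0ᶜ := hy.1
        have hy2 : (⟨y, hy1⟩ : (X0ᶜ : Set V)) ∈ S.verts := (hSv _).2 (hy.2 hy1)
        refine (hf _ _).2 ⟨⟨⟨y, hy1⟩, hy2⟩, ?_, rfl⟩
        have hadj : K.Adj w ⟨⟨y, hy1⟩, hy2⟩ := by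
          rw [hK, Subgraph.coe_adj]
          refine Subgraph.deleteVerts_adj.2 ⟨trivial, (hSv _).1 w.2, trivial, (hSv _).1 hy2, ?_⟩
          exact hxy
        exact (ConnectedComponent.mem_supp_congr_adj c hadj).1 hw

/-- Open neighbourhood of a set. -/
def nb (A : Finset V) : Finset V := A.biUnion fun x => G.neighborFinset x

theorem mem_nb {A : Finset V} {y : V} : y ∈ nb G A ↔ ∃ x ∈ A, G.Adj x y := by
  simp [nb]

theorem exists_small_surplus (hconn : G.Connected) (htri : G.CliqueFree 3)
    (hreg : G.IsRegularOfDegree 5) (heven : Even (Fintype.card V))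
    (hnfc : ¬ PFactorCritical G 4) (h6 : lambdaS G 6 = 12) :
    ∃ I : Finset V, I.Nonempty ∧ nb G I ≠ univ ∧ #(nb G I) ≤ #I + 3 := by
  obtain ⟨X, 𝒞, hX4, hXC, hdisj, hC⟩ := tutte_family G heven hnfc
  have hsum : ∑ C ∈ 𝒞, cut G C ≤ 5 * #X := by
    calc ∑ C ∈ 𝒞, cut G C ≤ ∑ C ∈ 𝒞, #(G.interedges C X) := by
          refine sum_le_sum fun C hCm => card_le_card ?_
          rintro ⟨x, y⟩ h
          simp only [mem_interedges_iff, mem_compl] at h ⊢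
          refine ⟨h.1, ?_, h.2.2⟩
          rcases (hC C hCm).2.2 x h.1 y h.2.2 with h' | h'
          · exact absurd h' h.2.1
          · exact h'
      _ = #(𝒞.biUnion fun C => G.interedges C X) := by
          rw [card_biUnion]
          intro C hCm D hDm hne
          exact G.interedges_disjoint_left (hdisj C hCm D hDm hne) X
      _ ≤ #(G.interedges univ X) := by
          refine card_le_card ?_
          intro p hp
          obtain ⟨C, _, h⟩ := mem_biUnion.1 hp
          exact G.interedges_mono (subset_univ _) subset_rfl h
      _ = 5 * #X := by rw [inter_comm, inter_univ G hreg]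
  have h1 : ∀ C ∈ 𝒞, #C = 1 → 5 ≤ cut G C := by
    intro C _ h
    have := cut_add G hreg C
    obtain ⟨Δ, hΔ, hb⟩ := small_inner G htri C
    rw [h] at hb hΔ this
    interval_cases Δ <;> omega
  have h3 : ∀ C ∈ 𝒞, ¬ #C = 1 → 11 ≤ cut G C := by
    intro C hCm h
    have hodd := (hC C hCm).1
    have hle : #X ≤ #Cᶜ := card_le_card fun x hx => by
      rw [mem_compl]; exact fun hxC => Finset.disjoint_left.1 (hC C hCm).2.1 hxC hx
    rw [Nat.odd_iff] at hodd
    exact cut_ge G hconn htri hreg h6 C (by omega) (by omega)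
  have hs1 : #(𝒞.filter fun C => #C = 1) * 5 ≤ ∑ C ∈ 𝒞.filter fun C => #C = 1, cut G C := by
    rw [← smul_eq_mul]
    exact card_nsmul_le_sum _ _ _ fun C h => h1 C (mem_filter.1 h).1 (mem_filter.1 h).2
  have hs2 : #(𝒞.filter fun C => ¬ #C = 1) * 11 ≤
      ∑ C ∈ 𝒞.filter fun C => ¬ #C = 1, cut G C := by
    rw [← smul_eq_mul]
    exact card_nsmul_le_sum _ _ _ fun C h => h3 C (mem_filter.1 h).1 (mem_filter.1 h).2
  have hs := sum_filter_add_sum_filter_not 𝒞 (fun C => #C = 1) (cut G)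
  have hc := card_filter_add_card_filter_not (s := 𝒞) (fun C => #C = 1)
  set 𝒟 := 𝒞.filter fun C => #C = 1 with h𝒟
  have hcardI : #(𝒟.biUnion id) = #𝒟 := by
    rw [card_biUnion]
    · rw [sum_congr rfl (g := fun _ => 1)]
      · simp
      · intro C h; exact (mem_filter.1 h).2
    · intro C h D h' hne
      exact hdisj C (mem_filter.1 h).1 D (mem_filter.1 h').1 hne
  have hne : (𝒟.biUnion id).Nonempty := by rw [← card_pos]; omega
  have hsub : nb G (𝒟.biUnion id) ⊆ X := by
    intro y hy
    obtain ⟨x, hx, hxy⟩ := (mem_nb G).1 hy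
    obtain ⟨C, hCm, hxC⟩ := mem_biUnion.1 hx
    obtain ⟨hCm, hC1⟩ := mem_filter.1 hCm
    rcases (hC C hCm).2.2 x hxC y hxy with h | h
    · have := card_le_one.1 hC1.le x hxC y h
      subst this; exact absurd hxy (G.irrefl)
    · exact h
  refine ⟨_, hne, ?_, ?_⟩
  · intro h
    obtain ⟨x, hx⟩ := hne
    obtain ⟨C, hCm, hxC⟩ := mem_biUnion.1 hx
    have := hsub (by rw [h]; exact mem_univ x)
    exact Finset.disjoint_left.1 (hC C (mem_filter.1 hCm).1).2.1 hxC this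
  · have := card_le_card hsub
    omega

end Tutte

section Atoms

variable {V : Type*} [Fintype V] [DecidableEq V] (G : SimpleGraph V) [DecidableRel G.Adj]

structure IsAt (I : Finset V) : Prop where
  ne : I.Nonempty
  nu : nb G I ≠ univ
  min1 : ∀ J : Finset V, J.Nonempty → nb G J ≠ univ → #(nb G I) + #J ≤ #(nb G J) + #I
  min2 : ∀ J : Finset V, J.Nonempty → nb G J ≠ univ → #(nb G J) + #I ≤ #(nb G I) + #J → #I ≤ #J

theorem nb_image (φ : G ≃g G) (J : Finset V) : nb G (J.image φ) = (nb G J).image φ := by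
  ext y
  simp only [mem_nb, mem_image]
  constructor
  · rintro ⟨_, ⟨x, hx, rfl⟩, h⟩
    refine ⟨φ.symm y, ⟨x, hx, ?_⟩, by simp⟩
    rw [← φ.map_adj_iff]; simpa using h
  · rintro ⟨z, ⟨x, hx, h⟩, rfl⟩
    exact ⟨φ x, ⟨x, hx, rfl⟩, φ.map_adj_iff.2 h⟩

theorem IsAt.image {I : Finset V} (h : IsAt G I) (φ : G ≃g G) : IsAt G (I.image φ) := by
  have hc : ∀ A : Finset V, #(A.image φ) = #A := fun A => card_image_of_injective _ φ.injective
  refine ⟨h.ne.image _, ?_, ?_, ?_⟩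
  · intro hu
    apply h.nu
    rw [← card_eq_iff_eq_univ] at hu ⊢
    rwa [nb_image, hc] at hu
  · intro J h1 h2; rw [nb_image, hc, hc]; exact h.min1 J h1 h2
  · intro J h1 h2; rw [nb_image, hc, hc]; exact h.min2 J h1 h2

theorem card_le_nb (hreg : G.IsRegularOfDegree 5) (A : Finset V) : #A ≤ #(nb G A) := by
  have h1 : #(G.interedges A univ) ≤ #(G.interedges univ (nb G A)) := by
    refine card_le_card ?_
    rintro ⟨x, y⟩ h
    simp only [mem_interedges_iff, mem_univ, true_and, mem_nb] at h ⊢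
    exact ⟨⟨x, h.1, h.2⟩, h.2⟩
  rw [inter_univ G hreg, inter_comm, inter_univ G hreg] at h1
  omega

theorem exists_at (hreg : G.IsRegularOfDegree 5) {I : Finset V} (h1 : I.Nonempty)
    (h2 : nb G I ≠ univ) : ∃ J, IsAt G J := by
  obtain ⟨A, hA, hmin⟩ := (univ.filter fun A : Finset V => A.Nonempty ∧ nb G A ≠ univ).exists_min_image
    (fun A => #(nb G A) - #A) ⟨I, by simp [h1, h2]⟩
  obtain ⟨B, hB, hminB⟩ := (univ.filter fun B : Finset V => B.Nonempty ∧ nb G B ≠ univ ∧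
    #(nb G B) - #B = #(nb G A) - #A).exists_min_image (fun A => #A) ⟨A, by simpa using hA⟩
  simp only [mem_filter, mem_univ, true_and] at hA hmin hB hminB
  refine ⟨B, hB.1, hB.2.1, ?_, ?_⟩
  · intro J hJ hJ'
    have := hmin J ⟨hJ, hJ'⟩
    have := card_le_nb G hreg J
    have := card_le_nb G hreg B
    omega
  · intro J hJ hJ' hle
    have := hmin J ⟨hJ, hJ'⟩
    have := card_le_nb G hreg J
    have := card_le_nb G hreg B
    exact hminB J ⟨hJ, hJ', by omega⟩

theorem IsAt.add_le {I : Finset V} (h : IsAt G I) : #I + #(nb G I) ≤ Fintype.card V := by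
  have hne : (nb G I)ᶜ.Nonempty := by
    rw [nonempty_iff_ne_empty, Ne, compl_eq_empty_iff]; exact h.nu
  have hsub : nb G (nb G I)ᶜ ⊆ Iᶜ := by
    intro y hy
    obtain ⟨x, hx, hxy⟩ := (mem_nb G).1 hy
    rw [mem_compl] at hx ⊢
    exact fun hyI => hx ((mem_nb G).2 ⟨y, hyI, hxy.symm⟩)
  have hc := card_le_card hsub
  have h1 := card_add_card_compl I
  have h2 := card_add_card_compl (nb G I)
  have hp := h.ne.card_pos
  have hnu : nb G (nb G I)ᶜ ≠ univ := by
    rw [Ne, ← card_eq_iff_eq_univ]; omega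
  have := h.min2 _ hne hnu (by omega)
  omega

theorem IsAt.card_eq {I J : Finset V} (hI : IsAt G I) (hJ : IsAt G J) :
    #I = #J ∧ #(nb G I) = #(nb G J) := by
  have h1 := hI.min1 J hJ.ne hJ.nu
  have h2 := hJ.min1 I hI.ne hI.nu
  have h3 := hI.min2 J hJ.ne hJ.nu (by omega)
  have h4 := hJ.min2 I hI.ne hI.nu (by omega)
  omega

theorem IsAt.eq_of_inter {I J : Finset V} (hI : IsAt G I) (hJ : IsAt G J)
    (hne : (I ∩ J).Nonempty) : I = J := by
  obtain ⟨hc, hcn⟩ := hI.card_eq G hJ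
  have hadd := hI.add_le G
  have hs1 : nb G (I ∩ J) ⊆ nb G I ∩ nb G J := by
    intro y hy
    obtain ⟨x, hx, hxy⟩ := (mem_nb G).1 hy
    rw [mem_inter] at hx ⊢
    exact ⟨(mem_nb G).2 ⟨x, hx.1, hxy⟩, (mem_nb G).2 ⟨x, hx.2, hxy⟩⟩
  have hs2 : nb G (I ∪ J) = nb G I ∪ nb G J := by
    ext y; simp only [mem_nb, mem_union, or_and_right, exists_or]
  have hnu : nb G (I ∩ J) ≠ univ := by
    intro h
    apply hI.nu
    rw [eq_univ_iff_forall] at h ⊢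
    exact fun x => (mem_inter.1 (hs1 (h x))).1
  have h1 := hI.min1 _ hne hnu
  have h2 := card_le_card hs1
  have h3 := card_union_add_card_inter (nb G I) (nb G J)
  have h4 := card_union_add_card_inter I J
  have hp := hne.card_pos
  rw [← hs2] at h3
  have hnu2 : nb G (I ∪ J) ≠ univ := by
    rw [Ne, ← card_eq_iff_eq_univ]; omega
  have h5 := hI.min1 _ (hI.ne.mono subset_union_left) hnu2
  have h6 := hI.min2 _ hne hnu (by omega)
  have h7 : I ∩ J = I := eq_of_subset_of_card_le inter_subset_left h6
  exact eq_of_subset_of_card_le (inter_eq_left.1 h7) hc.ge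

theorem IsAt.two_le {I : Finset V} (hI : IsAt G I) (hb : #I ≠ 1) {x : V} (hx : x ∈ nb G I) :
    2 ≤ #(G.neighborFinset x ∩ I) := by
  obtain ⟨i, hi, hix⟩ := (mem_nb G).1 hx
  by_contra hlt
  have hmem : i ∈ G.neighborFinset x ∩ I := by simp [hi, hix.symm]
  have hone : ∀ j ∈ I, G.Adj j x → j = i := by
    intro j hj hjx
    exact card_le_one.1 (by omega) j (by simp [hj, hjx.symm]) i hmem
  have hcard := card_erase_of_mem hi
  have hpos := hI.ne.card_pos
  have hne : (I.erase i).Nonempty := by rw [← card_pos]; omega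
  have hsub : nb G (I.erase i) ⊆ (nb G I).erase x := by
    intro y hy
    obtain ⟨j, hj, hjy⟩ := (mem_nb G).1 hy
    rw [mem_erase] at hj ⊢
    refine ⟨?_, (mem_nb G).2 ⟨j, hj.2, hjy⟩⟩
    rintro rfl
    exact hj.1 (hone j hj.2 hjy)
  have hc := card_le_card hsub
  rw [card_erase_of_mem hx] at hc
  have hpx := card_pos.2 ⟨x, hx⟩
  have hnu : nb G (I.erase i) ≠ univ := by
    intro h
    have := hsub (by rw [h]; exact mem_univ x)
    simp at this
  have := hI.min2 _ hne hnu (by omega)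
  omega

open Classical in
theorem contradiction_of_surplus (hconn : G.Connected) (hvt : VertexTransitive G)
    (hnb : ¬ G.Colorable 2) (htri : G.CliqueFree 3) (hreg : G.IsRegularOfDegree 5)
    (heven : Even (Fintype.card V))
    {I0 : Finset V} (hI0 : I0.Nonempty) (hI0u : nb G I0 ≠ univ) (hI03 : #(nb G I0) ≤ #I0 + 3) :
    False := by
  obtain ⟨I, hI⟩ := exists_at G hreg hI0 hI0u
  have hk : #(nb G I) ≤ #I + 3 := by
    have := hI.min1 I0 hI0 hI0u; omega
  have hN5 : ∀ x, #(G.neighborFinset x) = 5 := fun x => by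
    rw [card_neighborFinset_eq_degree]; exact hreg x
  have hb1 : #I ≠ 1 := by
    intro h
    obtain ⟨a, rfl⟩ := card_eq_one.1 h
    have : nb G {a} = G.neighborFinset a := by simp [nb]
    rw [this, hN5] at hk; simp at hk
  let 𝓑 : Finset (Finset V) := univ.filter (IsAt G)
  have h𝓑 : ∀ B, B ∈ 𝓑 ↔ IsAt G B := by simp [𝓑]
  have hcov : ∀ v, ∃ B, IsAt G B ∧ v ∈ B := by
    intro v
    obtain ⟨a, ha⟩ := hI.ne
    obtain ⟨φ, rfl⟩ := hvt a v
    exact ⟨_, hI.image G φ, mem_image_of_mem _ ha⟩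
  have hcB : ∀ B, IsAt G B → #B = #I ∧ #(nb G B) = #(nb G I) := fun B hB => hB.card_eq G hI
  have h2 : ∀ B, IsAt G B → ∀ x ∈ nb G B, 2 ≤ #(G.neighborFinset x ∩ B) := fun B hB x hx =>
    hB.two_le G (by rw [(hcB B hB).1]; exact hb1) hx
  have hdis : ∀ B, IsAt G B → ∀ C, IsAt G C → B ≠ C → Disjoint B C := by
    intro B hB C hC hne
    by_contra h
    rw [Finset.disjoint_iff_inter_eq_empty] at h
    exact hne (hB.eq_of_inter G hC (nonempty_iff_ne_empty.2 h))
  have hunion : ∀ A : Finset V, ∑ B ∈ 𝓑, #(A ∩ B) = #A := by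
    intro A
    rw [← card_biUnion]
    · congr 1
      ext x
      simp only [mem_biUnion, mem_inter, h𝓑]
      constructor
      · rintro ⟨_, _, h, _⟩; exact h
      · intro h; obtain ⟨B, hB, hx⟩ := hcov x; exact ⟨B, hB, h, hx⟩
    · intro B hB C hC hne
      exact (hdis B ((h𝓑 B).1 hB) C ((h𝓑 C).1 hC) hne).mono inter_subset_right inter_subset_right
  have hn : #𝓑 * #I = Fintype.card V := by
    have h := hunion univ
    simp only [Finset.univ_inter, card_univ] at h
    rw [← h, sum_congr rfl (g := fun _ => #I)]
    · simp
    · intro B hB; exact (hcB B ((h𝓑 B).1 hB)).1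
  -- blocks touched by a vertex
  let T : V → Finset (Finset V) := fun x => 𝓑.filter fun B => x ∈ nb G B
  have hT : ∀ x B, B ∈ T x ↔ IsAt G B ∧ x ∈ nb G B := by intro x B; simp [T, h𝓑]
  have hTsum : ∀ x, ∑ B ∈ T x, #(G.neighborFinset x ∩ B) = 5 := by
    intro x
    rw [← hN5 x, ← hunion (G.neighborFinset x)]
    refine sum_subset (filter_subset _ _) ?_
    intro B hB hBT
    rw [card_eq_zero, eq_empty_iff_forall_notMem]
    intro y hy
    simp only [mem_inter, mem_neighborFinset] at hy
    exact hBT ((hT x B).2 ⟨(h𝓑 B).1 hB, (mem_nb G).2 ⟨y, hy.2, hy.1.symm⟩⟩)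
  have hT2 : ∀ x, #(T x) ≤ 2 := by
    intro x
    have : #(T x) * 2 ≤ ∑ B ∈ T x, #(G.neighborFinset x ∩ B) := by
      rw [← smul_eq_mul]
      exact card_nsmul_le_sum _ _ _ fun B hB => h2 B ((hT x B).1 hB).1 x ((hT x B).1 hB).2
    rw [hTsum] at this; omega
  have hT1 : ∀ x, 1 ≤ #(T x) := by
    intro x
    by_contra h
    have h0 : T x = ∅ := by rw [← card_eq_zero]; omega
    have := hTsum x
    rw [h0] at this; simp at this
  have hTim : ∀ (φ : G ≃g G) x, #(T x) ≤ #(T (φ x)) := by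
    intro φ x
    refine card_le_card_of_injOn (fun B => B.image φ) ?_ ?_
    · intro B hB
      have hB' := (hT x B).1 hB
      refine (hT _ _).2 ⟨hB'.1.image G φ, ?_⟩
      rw [nb_image]; exact mem_image_of_mem _ hB'.2
    · intro B _ C _ h
      exact image_injective φ.injective h
  have hTc : ∀ x y, #(T x) = #(T y) := by
    intro x y
    obtain ⟨φ, h1⟩ := hvt x y
    obtain ⟨ψ, h2⟩ := hvt y x
    have := hTim φ x
    have := hTim ψ y
    rw [h1] at *; rw [h2] at *
    omega
  obtain ⟨a0, ha0⟩ := hI.ne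
  have hdc : ∑ x : V, #(T x) = #𝓑 * #(nb G I) := by
    have := sum_card_bipartiteAbove_eq_sum_card_bipartiteBelow (s := (univ : Finset V)) (t := 𝓑)
      (fun x B => x ∈ nb G B)
    unfold bipartiteAbove bipartiteBelow at this
    rw [this, sum_congr rfl (g := fun _ => #(nb G I))]
    · simp
    · intro B hB
      rw [← (hcB B ((h𝓑 B).1 hB)).2]
      congr 1; ext; simp
  have hdc' : Fintype.card V * #(T a0) = #𝓑 * #(nb G I) := by
    rw [← hdc, sum_congr rfl (g := fun _ => #(T a0)) fun x _ => hTc x a0]; simp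
  have hBpos : 0 < #𝓑 := card_pos.2 ⟨I, (h𝓑 I).2 hI⟩
  have hnbI : #I * #(T a0) = #(nb G I) := by
    rw [← hn, mul_assoc] at hdc'
    exact Nat.eq_of_mul_eq_mul_left hBpos hdc'
  have hcase : #(T a0) = 1 ∨ #(T a0) = 2 := by
    have := hT1 a0; have := hT2 a0; omega
  rcases hcase with hr | hr
  · -- bipartite with parts `I` and its complement
    have hNI : ∀ x ∈ nb G I, ∀ y, G.Adj x y → y ∈ I := by
      intro x hx y hxy
      obtain ⟨B, hB, hy⟩ := hcov y
      have h1 : B ∈ T x := (hT x B).2 ⟨hB, (mem_nb G).2 ⟨y, hy, hxy.symm⟩⟩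
      have h2 : I ∈ T x := (hT x I).2 ⟨hI, hx⟩
      have := card_le_one.1 (by rw [hTc x a0, hr]) B h1 I h2
      rwa [this] at hy
    have hcl1 : ∀ x y, x ∈ I → x ∈ nb G I → y ∈ nb G I := by
      intro x y hx hx'
      have : y ∈ {z | z ∈ I ∧ z ∈ nb G I} := by
        refine closed_univ (H := G) ?_ (hconn.preconnected x y) ⟨hx, hx'⟩
        intro z hz w hzw
        exact ⟨hNI z hz.2 w hzw, (mem_nb G).2 ⟨z, hz.1, hzw⟩⟩
      exact this.2
    have hdj : ∀ x, x ∈ I → x ∉ nb G I := by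
      intro x hx hx'
      exact hI.nu (eq_univ_iff_forall.2 fun y => hcl1 x y hx hx')
    have hcl2 : ∀ y, y ∈ I ∨ y ∈ nb G I := by
      intro y
      have : y ∈ {z | z ∈ I ∨ z ∈ nb G I} := by
        refine closed_univ (H := G) ?_ (hconn.preconnected a0 y) (Or.inl ha0)
        intro z hz w hzw
        rcases hz with hz | hz
        · exact Or.inr ((mem_nb G).2 ⟨z, hz, hzw⟩)
        · exact Or.inl (hNI z hz w hzw)
      exact this
    apply hnb
    refine ⟨Coloring.mk (fun w => if w ∈ I then (0 : Fin 2) else 1) ?_⟩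
    intro x y hxy
    by_cases hx : x ∈ I
    · have hy : y ∉ I := fun hy => hdj y hy ((mem_nb G).2 ⟨x, hx, hxy⟩)
      simp [hx, hy]
    · have hy : y ∈ I := hNI x ((hcl2 x).resolve_left hx) y hxy
      simp [hx, hy]
  · -- blocks of size three arranged in a cycle
    have hT2' : ∀ x, #(T x) = 2 := fun x => (hTc x a0).trans hr
    have hpair : ∀ x, ∃ B1 B2, B1 ≠ B2 ∧ T x = {B1, B2} ∧
        #(G.neighborFinset x ∩ B1) + #(G.neighborFinset x ∩ B2) = 5 := by
      intro x
      obtain ⟨B1, B2, hne, h⟩ := card_eq_two.1 (hT2' x)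
      refine ⟨B1, B2, hne, h, ?_⟩
      rw [← hTsum x, h, sum_pair hne]
    have hb3 : #I = 3 := by
      obtain ⟨B1, B2, hne, h, hs⟩ := hpair a0
      have hB1 : IsAt G B1 := ((hT a0 B1).1 (by rw [h]; simp)).1
      have hB2 : IsAt G B2 := ((hT a0 B2).1 (by rw [h]; simp)).1
      have c1 : #(G.neighborFinset a0 ∩ B1) ≤ #B1 := card_le_card inter_subset_right
      have c2 : #(G.neighborFinset a0 ∩ B2) ≤ #B2 := card_le_card inter_subset_right
      rw [(hcB _ hB1).1] at c1
      rw [(hcB _ hB2).1] at c2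
      rw [hr] at hnbI
      omega
    have hnb6 : #(nb G I) = 6 := by rw [← hnbI, hb3, hr]
    have hself : ∀ B, IsAt G B → ∀ x ∈ B, x ∉ nb G B := by
      intro B hB x hx hxn
      obtain ⟨y, hy, hyx⟩ := (mem_nb G).1 hxn
      have c1 := h2 B hB x hxn
      have c2 := h2 B hB y ((mem_nb G).2 ⟨x, hx, hyx.symm⟩)
      have hd : Disjoint (G.neighborFinset x ∩ B) (G.neighborFinset y ∩ B) := by
        rw [Finset.disjoint_left]
        intro z hz hz'
        simp only [mem_inter, mem_neighborFinset] at hz hz'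
        exact htri {x, y, z} (is3Clique_triple_iff.2 ⟨hyx.symm, hz.1, hz'.1⟩)
      have c3 : #((G.neighborFinset x ∩ B) ∪ (G.neighborFinset y ∩ B)) ≤ #B :=
        card_le_card (union_subset inter_subset_right inter_subset_right)
      rw [card_union_of_disjoint hd, (hcB B hB).1] at c3
      omega
    -- all vertices of a block touch the same blocks
    have hsame : ∀ B, IsAt G B → ∀ x ∈ B, ∀ y ∈ B, T y ⊆ T x := by
      intro B hB x hx y hy D hD
      obtain ⟨B1, B2, hne, h, hs⟩ := hpair x
      by_contra hDn
      have hD' := (hT y D).1 hD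
      have hB1 : IsAt G B1 := ((hT x B1).1 (by rw [h]; simp)).1
      have hB2 : IsAt G B2 := ((hT x B2).1 (by rw [h]; simp)).1
      rw [h] at hDn
      simp only [mem_insert, mem_singleton, not_or] at hDn
      have c1 := h2 D hD'.1 y hD'.2
      have d12 : Disjoint (G.neighborFinset x ∩ B1) (G.neighborFinset x ∩ B2) :=
        (hdis B1 hB1 B2 hB2 hne).mono inter_subset_right inter_subset_right
      have d1D : Disjoint (G.neighborFinset x ∩ B1) (G.neighborFinset y ∩ D) :=
        (hdis B1 hB1 D hD'.1 (Ne.symm hDn.1)).mono inter_subset_right inter_subset_right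
      have d2D : Disjoint (G.neighborFinset x ∩ B2) (G.neighborFinset y ∩ D) :=
        (hdis B2 hB2 D hD'.1 (Ne.symm hDn.2)).mono inter_subset_right inter_subset_right
      have hsx : ∀ A, G.neighborFinset x ∩ A ⊆ nb G B := by
        intro A z hz
        simp only [mem_inter, mem_neighborFinset] at hz
        exact (mem_nb G).2 ⟨x, hx, hz.1⟩
      have hsy : G.neighborFinset y ∩ D ⊆ nb G B := by
        intro z hz
        simp only [mem_inter, mem_neighborFinset] at hz
        exact (mem_nb G).2 ⟨y, hy, hz.1⟩
      have c2 := card_le_card (union_subset (union_subset (hsx B1) (hsx B2)) hsy)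
      rw [card_union_of_disjoint (disjoint_union_left.2 ⟨d1D, d2D⟩), card_union_of_disjoint d12,
        (hcB B hB).2] at c2
      omega
    let W := {B : Finset V // IsAt G B}
    let Q : SimpleGraph W :=
      { Adj := fun B C => B ≠ C ∧ ∃ x ∈ B.1, ∃ y ∈ C.1, G.Adj x y
        symm := ⟨fun B C h => by
          obtain ⟨hne, x, hx, y, hy, hxy⟩ := h
          exact ⟨hne.symm, y, hy, x, hx, hxy.symm⟩⟩
        loopless := ⟨fun B h => h.1 rfl⟩ }
    choose blk hblk hmem using hcov
    let f : V → W := fun v => ⟨blk v, hblk v⟩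
    have hfadj : ∀ x y, G.Adj x y → Q.Adj (f x) (f y) := by
      intro x y hxy
      refine ⟨?_, x, hmem x, y, hmem y, hxy⟩
      intro h
      have h' : blk x = blk y := congrArg Subtype.val h
      exact hself (blk y) (hblk y) y (hmem y) ((mem_nb G).2 ⟨x, h' ▸ hmem x, hxy⟩)
    let F : G →g Q := ⟨f, fun h => hfadj _ _ h⟩
    have hsurj : Function.Surjective F := by
      rintro ⟨B, hB⟩
      obtain ⟨x, hx⟩ := hB.ne
      refine ⟨x, Subtype.ext ?_⟩
      exact (hblk x).eq_of_inter G hB ⟨x, mem_inter.2 ⟨hmem x, hx⟩⟩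
    have hQc : Q.Connected := hconn.map F hsurj
    have hWc : Fintype.card W = #𝓑 := Fintype.card_subtype _
    have hWe : Even (Fintype.card W) := by
      rw [hWc]
      rw [← hn, hb3] at heven
      rw [Nat.even_iff] at heven ⊢
      omega
    have hQ2 : ∀ B, (Q.neighborSet B).ncard = 2 := by
      rintro ⟨B, hB⟩
      obtain ⟨a, ha⟩ := hB.ne
      rw [← hT2' a, ← Set.ncard_coe_finset]
      refine Set.ncard_congr (fun C _ => C.1) ?_ ?_ ?_
      · rintro ⟨C, hC⟩ ⟨_, x, hx, y, hy, hxy⟩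
        exact hsame B hB a ha x hx ((hT x C).2 ⟨hC, (mem_nb G).2 ⟨y, hy, hxy.symm⟩⟩)
      · intro C D _ _ h; exact Subtype.ext h
      · intro C hC
        obtain ⟨hC1, hC2⟩ := (hT a C).1 hC
        obtain ⟨y, hy, hya⟩ := (mem_nb G).1 hC2
        refine ⟨⟨C, hC1⟩, ⟨?_, a, ha, y, hy, hya.symm⟩, rfl⟩
        intro h
        have h' : B = C := congrArg Subtype.val h
        exact hself B hB a ha (by rw [h']; exact hC2)
    have hcol := cycle_two_colorable Q hQc hWe hQ2
    exact hnb (hcol.of_hom F)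

end Atoms

end Aux

/-- (Lemma 3.5) `G` connected vertex-transitive non-bipartite
triangle-free of degree 5 and even order, not 4-factor-critical, with
`λ₆(G) = λ₇(G) = 12`. Then every `λ₇`-atom of `G` is an imprimitive block. -/
theorem statement13 {V : Type*} [Fintype V] [DecidableEq V]
    (G : SimpleGraph V) [DecidableRel G.Adj]
    (hconn : G.Connected) (hvt : VertexTransitive G) (hnb : ¬ G.Colorable 2)
    (htri : G.CliqueFree 3) (hreg : G.IsRegularOfDegree 5)
    (heven : Even (Fintype.card V)) (hnfc : ¬ PFactorCritical G 4)
    (h6 : lambdaS G 6 = 12) (h7 : lambdaS G 7 = 12)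
    (S : Set V) (hS : IsLambdaAtom G 7 S) :
    IsImprimitiveBlock G S := by
  exfalso
  obtain ⟨I, h1, h2, h3⟩ := Aux.exists_small_surplus G hconn htri hreg heven hnfc h6
  exact Aux.contradiction_of_surplus G hconn hvt hnb htri hreg heven h1 h2 h3
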